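/- Let E ⊆ M be a V-adapted trivializing subspace. Using the decomposition N = ⊕_{k∈ℤ} z^k·E, set Ě := {φ ∈ N^∨ : φ(E) ⊆ ℂ·1}, the copy of Hom_ℂ(E,ℂ) inside N^∨. Then: (i) Ě ⊆ M^∨ and M^∨ = ⊕_{j≥0} z^j·Ě; (ii) for every γ ∈ ℝ, V^∨_γ = ⊕_{k∈ℤ} z^k·{φ ∈ Ě : φ(V_{<k−γ} ∩ E) = 0}; (iii) consequently, Ě is a V-adapted trivializing subspace for (M^∨, (V^∨_γ)) and V^∨_γ ∩ Ě = {φ ∈ Ě : φ(V_{<−γ} ∩ E) = 0}. (Intermediate decomposition established in the proof of Proposition 3.2.15 of 'Irregular Hodge theory'.) -/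

import Mathlib

noncomputable section

open Submodule Set LaurentPolynomial

open scoped TensorProduct

/-- The ring `ℂ[z,z⁻¹]` of Laurent polynomials. -/
abbrev L : Type := LaurentPolynomial ℂ

variable {N : Type*} [AddCommGroup N] [Module ℂ N]

/-- `M` is (the image of) a finite free `ℂ[z]`-module of rank `r` inside
`N = ℂ[z,z⁻¹] ⊗_{ℂ[z]} M`, where multiplication by `z` is the automorphism `z` of `N`.
This is encoded by `z`-stability of `M` together with the existence of an `r`-element
family `b` of elements of `M` such that `(z^k (b i))` for `k ∈ ℤ` is a `ℂ`-basis of `N`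
and `(z^k (b i))` for `k ∈ ℕ` is a `ℂ`-basis of `M`. -/
def IsFreeLattice (z : N ≃ₗ[ℂ] N) (M : Submodule ℂ N) (r : ℕ) : Prop :=
  (∀ x ∈ M, z x ∈ M) ∧
  ∃ b : Fin r → N,
    LinearIndependent ℂ (fun p : Fin r × ℤ => (z ^ p.2) (b p.1)) ∧
    Submodule.span ℂ (Set.range fun p : Fin r × ℤ => (z ^ p.2) (b p.1)) = ⊤ ∧
    Submodule.span ℂ (Set.range fun p : Fin r × ℕ => (z ^ (p.2 : ℤ)) (b p.1)) = M

/-- A V-lattice filtration on `N` (with jumps in `A + ℤ`, `A ⊆ [0,1)` finite):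
(i) increasing; (ii) `z · V_β = V_{β+1}`; (iii) each `V_β` is stable under `z⁻¹` and
finitely generated over `ℂ[z⁻¹]`; (iv) the `ℂ[z,z⁻¹]`-span of each `V_β` is `N`;
(v) `V_β = V_γ` if `(β,γ] ∩ (A + ℤ) = ∅`. -/
structure IsVLattice (z : N ≃ₗ[ℂ] N) (V : ℝ → Submodule ℂ N) (A : Finset ℝ) : Prop where
  mono : Monotone V
  map_z : ∀ β : ℝ, (V β).map z.toLinearMap = V (β + 1)
  zinv_stable : ∀ β : ℝ, ∀ x ∈ V β, z.symm x ∈ V β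
  fg_zinv : ∀ β : ℝ, ∃ S : Finset N, (S : Set N) ⊆ (V β : Set N) ∧
    V β = Submodule.span ℂ {x : N | ∃ k : ℕ, ∃ s ∈ S, x = (z.symm ^ k) s}
  span_laurent : ∀ β : ℝ, Submodule.span ℂ {x : N | ∃ k : ℤ, ∃ v ∈ V β, x = (z ^ k) v} = ⊤
  jumpsIn : ∀ a ∈ A, (0 : ℝ) ≤ a ∧ a < 1
  jumps : ∀ β γ : ℝ, β ≤ γ →
    (∀ a ∈ A, ∀ k : ℤ, ¬ (β < a + k ∧ a + k ≤ γ)) → V β = V γ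

/-- `V_{<β} := ⋃_{γ < β} V_γ`. -/
def Vlt (V : ℝ → Submodule ℂ N) (β : ℝ) : Submodule ℂ N := ⨆ γ ∈ Set.Iio β, V γ

/-- Multiplication by `z` (the Laurent variable `T 1`) as a `ℂ`-linear automorphism of a
`ℂ[z,z⁻¹]`-module. -/
def zmul (N : Type*) [AddCommGroup N] [Module L N] [Module ℂ N] [IsScalarTower ℂ L N] :
    N ≃ₗ[ℂ] N where
  toFun x := (T 1 : L) • x
  invFun x := (T (-1) : L) • x
  map_add' x y := smul_add _ x y
  map_smul' c x := smul_comm (T 1 : L) c x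
  left_inv x := by show (T (-1) : L) • (T 1 : L) • x = x; rw [smul_smul, ← T_add]; simp
  right_inv x := by show (T 1 : L) • (T (-1) : L) • x = x; rw [smul_smul, ← T_add]; simp

/-- `T` is the internal direct sum of the family of subspaces `W`. -/
def IsInternalDirectSum {P : Type*} [AddCommGroup P] [Module ℂ P] {ι : Type*}
    (W : ι → Submodule ℂ P) (T : Submodule ℂ P) : Prop :=
  iSup W = T ∧ ∀ i : ι, W i ⊓ (⨆ (j : ι) (_ : j ≠ i), W j) = ⊥

/-- `E` is a V-adapted trivializing subspace for `M`. -/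
def IsVAdapted (z : N ≃ₗ[ℂ] N) (V : ℝ → Submodule ℂ N) (M E : Submodule ℂ N) : Prop :=
  E ≤ M ∧
  IsInternalDirectSum (fun j : ℕ => E.map ((z ^ (j : ℤ)).toLinearMap)) M ∧
  ∀ γ : ℝ, IsInternalDirectSum
    (fun j : ℕ => ((V (γ - j) ⊓ E).map ((z ^ (j : ℤ)).toLinearMap))) (V γ ⊓ M)

/-- The subring `ℂ[z] ⊆ ℂ[z,z⁻¹]` (as a `ℂ`-subspace, spanned by the `zⁿ`, `n ≥ 0`). -/
def polyZ : Submodule ℂ L := Submodule.span ℂ (Set.range fun n : ℕ => (T (n : ℤ) : L))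

/-- The subring `ℂ[z⁻¹] ⊆ ℂ[z,z⁻¹]`. -/
def polyZinv : Submodule ℂ L :=
  Submodule.span ℂ (Set.range fun n : ℕ => (T (-(n : ℤ)) : L))

variable {NN : Type*} [AddCommGroup NN] [Module L NN] [Module ℂ NN] [IsScalarTower ℂ L NN]

/-- `M^∨ = {φ ∈ N^∨ : φ(M) ⊆ ℂ[z]}` inside `N^∨ = Hom_{ℂ[z,z⁻¹]}(N, ℂ[z,z⁻¹])`. -/
def dualM (M : Submodule ℂ NN) : Submodule ℂ (NN →ₗ[L] L) where
  carrier := {φ | ∀ m ∈ M, φ m ∈ polyZ}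
  add_mem' := by
    intro φ ψ hφ hψ m hm
    rw [LinearMap.add_apply]; exact add_mem (hφ m hm) (hψ m hm)
  zero_mem' := by intro m hm; rw [LinearMap.zero_apply]; exact zero_mem _
  smul_mem' := by
    intro c φ hφ m hm
    rw [LinearMap.smul_apply]; exact Submodule.smul_mem _ c (hφ m hm)

/-- The dual filtration `V^∨_γ = {φ ∈ N^∨ : φ(V_{<1−γ}) ⊆ ℂ[z⁻¹]}`. -/
def dualV (V : ℝ → Submodule ℂ NN) (γ : ℝ) : Submodule ℂ (NN →ₗ[L] L) where
  carrier := {φ | ∀ x ∈ Vlt V (1 - γ), φ x ∈ polyZinv}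
  add_mem' := by
    intro φ ψ hφ hψ x hx
    rw [LinearMap.add_apply]; exact add_mem (hφ x hx) (hψ x hx)
  zero_mem' := by intro x hx; rw [LinearMap.zero_apply]; exact zero_mem _
  smul_mem' := by
    intro c φ hφ x hx
    rw [LinearMap.smul_apply]; exact Submodule.smul_mem _ c (hφ x hx)

/-- `Ě := {φ ∈ N^∨ : φ(E) ⊆ ℂ·1}`, the copy of `Hom_ℂ(E,ℂ)` inside `N^∨`. -/
def dualE (E : Submodule ℂ NN) : Submodule ℂ (NN →ₗ[L] L) where
  carrier := {φ | ∀ e ∈ E, ∃ c : ℂ, φ e = algebraMap ℂ L c}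
  add_mem' := by
    intro φ ψ hφ hψ e he
    obtain ⟨c, hc⟩ := hφ e he
    obtain ⟨c', hc'⟩ := hψ e he
    exact ⟨c + c', by rw [LinearMap.add_apply, hc, hc', map_add]⟩
  zero_mem' := by intro e he; exact ⟨0, by rw [LinearMap.zero_apply, map_zero]⟩
  smul_mem' := by
    intro c φ hφ e he
    obtain ⟨c', hc'⟩ := hφ e he
    exact ⟨c * c', by
      rw [LinearMap.smul_apply, hc', Algebra.smul_def, map_mul]⟩

/-- The annihilator of a subspace `S ⊆ N` inside `N^∨`. -/
def annih (S : Submodule ℂ NN) : Submodule ℂ (NN →ₗ[L] L) where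
  carrier := {φ | ∀ x ∈ S, φ x = 0}
  add_mem' := by
    intro φ ψ hφ hψ x hx
    rw [LinearMap.add_apply, hφ x hx, hψ x hx, add_zero]
  zero_mem' := by intro x hx; rw [LinearMap.zero_apply]
  smul_mem' := by
    intro c φ hφ x hx
    rw [LinearMap.smul_apply, hφ x hx, smul_zero]

/-- Multiplication by `z^k` on `N^∨`, as a `ℂ`-linear endomorphism. -/
def lT (k : ℤ) : (NN →ₗ[L] L) →ₗ[ℂ] (NN →ₗ[L] L) where
  toFun φ := (T k : L) • φ
  map_add' φ ψ := smul_add _ _ _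
  map_smul' c φ := by
    refine LinearMap.ext fun x => ?_
    simp only [LinearMap.smul_apply, RingHom.id_apply]
    exact smul_comm (T k : L) c (φ x)

theorem zmul_zpow_apply (k : ℤ) (x : NN) : (zmul NN ^ k) x = (T k : L) • x := by
  induction k with
  | zero => simp
  | succ n ih =>
    rw [add_comm, zpow_add, zpow_one, LinearEquiv.mul_apply, ih, T_add, mul_smul]; rfl
  | pred n ih =>
    rw [sub_eq_add_neg, add_comm, zpow_add, zpow_neg_one, LinearEquiv.mul_apply, ih, T_add,
      mul_smul]; rfl

theorem T_smul_T_smul {P : Type*} [AddCommGroup P] [Module L P] (j k : ℤ) (x : P) :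
    (T j : L) • (T k : L) • x = (T (j + k) : L) • x := by
  rw [smul_smul, ← T_add]

theorem coeff_T_mul (n k : ℤ) (f : L) : (T n * f : L).coeff k = f.coeff (k - n) := by
  have h := AddMonoidAlgebra.coeff_single_mul_add f (1 : ℂ) n (k - n)
  rwa [add_sub_cancel, one_mul] at h

theorem coeff_algebraMap_of_ne {k : ℤ} (hk : k ≠ 0) (c : ℂ) :
    (algebraMap ℂ L c).coeff k = 0 := by
  rw [← C_eq_algebraMap, C_apply, if_neg hk]

theorem coeff_algebraMap_zero (c : ℂ) : (algebraMap ℂ L c).coeff 0 = c := by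
  rw [← C_eq_algebraMap, C_apply, if_pos rfl]

theorem eq_sum_coeff_smul_T (f : L) {S : Finset ℤ} (hS : f.coeff.support ⊆ S) :
    f = ∑ k ∈ S, f.coeff k • (T k : L) := by
  apply LaurentPolynomial.ext
  intro a
  simp only [AddMonoidAlgebra.coeff_sum, AddMonoidAlgebra.coeff_smul, Finsupp.finsetSum_apply,
    Finsupp.smul_apply, T_apply, smul_eq_mul, mul_ite, mul_one, mul_zero, Finset.sum_ite_eq']
  split_ifs with h
  · rfl
  · exact Finsupp.notMem_support_iff.mp fun h' => h (hS h')

theorem coeff_eq_zero_of_mem_polyZ {f : L} (hf : f ∈ polyZ) {k : ℤ} (hk : k < 0) :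
    f.coeff k = 0 := by
  induction hf using Submodule.span_induction with
  | mem x hx => obtain ⟨n, rfl⟩ := hx; rw [T_apply, if_neg (by omega)]
  | zero => rfl
  | add x y _ _ hx hy => rw [AddMonoidAlgebra.coeff_add, Finsupp.add_apply, hx, hy, add_zero]
  | smul c x _ hx => rw [AddMonoidAlgebra.coeff_smul_apply, hx, smul_zero]

theorem coeff_eq_zero_of_mem_polyZinv {f : L} (hf : f ∈ polyZinv) {k : ℤ} (hk : 0 < k) :
    f.coeff k = 0 := by
  induction hf using Submodule.span_induction with
  | mem x hx => obtain ⟨n, rfl⟩ := hx; rw [T_apply, if_neg (by omega)]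
  | zero => rfl
  | add x y _ _ hx hy => rw [AddMonoidAlgebra.coeff_add, Finsupp.add_apply, hx, hy, add_zero]
  | smul c x _ hx => rw [AddMonoidAlgebra.coeff_smul_apply, hx, smul_zero]

theorem T_mul_algebraMap_mem_polyZ {k : ℤ} (hk : 0 ≤ k) (c : ℂ) :
    T k * algebraMap ℂ L c ∈ polyZ := by
  rw [mul_comm, ← Algebra.smul_def]
  refine Submodule.smul_mem _ _ (Submodule.subset_span ⟨k.toNat, ?_⟩)
  simp only [Int.toNat_of_nonneg hk]

theorem T_mul_algebraMap_mem_polyZinv {k : ℤ} (hk : k ≤ 0) (c : ℂ) :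
    T k * algebraMap ℂ L c ∈ polyZinv := by
  rw [mul_comm, ← Algebra.smul_def]
  refine Submodule.smul_mem _ _ (Submodule.subset_span ⟨(-k).toNat, ?_⟩)
  simp only [Int.toNat_of_nonneg (neg_nonneg.mpr hk), neg_neg]

theorem T_smul_mem_of_isVLattice {V : ℝ → Submodule ℂ NN} {A : Finset ℝ}
    (hV : IsVLattice (zmul NN) V A) (k : ℤ) :
    ∀ {β : ℝ} {x : NN}, x ∈ V β → (T k : L) • x ∈ V (β + k) := by
  induction k with
  | zero => intro β x hx; simpa using hx
  | succ n ih =>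
    intro β x hx
    have h : zmul NN ((T (n : ℤ) : L) • x) ∈ V (β + (n : ℤ) + 1) := by
      rw [← hV.map_z]
      exact Submodule.mem_map_of_mem (ih hx)
    rw [add_comm (n : ℤ) 1, ← T_smul_T_smul]
    convert h using 2
    · push_cast
      ring
    · rfl
  | pred n ih =>
    intro β x hx
    have h := ih hx
    rw [show β + ((-(n : ℤ) : ℤ) : ℝ) = (β + ((-(n : ℤ) - 1 : ℤ) : ℝ)) + 1 by push_cast; ring,
      ← hV.map_z] at h
    obtain ⟨y, hy, hyx⟩ := h
    have : (T (-(n : ℤ) - 1) : L) • x = y := by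
      rw [sub_eq_add_neg, add_comm, ← T_smul_T_smul, ← hyx]
      exact (zmul NN).symm_apply_apply y
    rwa [this]

theorem mem_Vlt_iff {V : ℝ → Submodule ℂ N} (hV : Monotone V) {β : ℝ} {x : N} :
    x ∈ Vlt V β ↔ ∃ γ < β, x ∈ V γ := by
  have : Nonempty (Set.Iio β) := ⟨⟨β - 1, sub_one_lt β⟩⟩
  have hdir : Directed (· ≤ ·) fun γ : Set.Iio β => V γ :=
    (hV.comp (Subtype.mono_coe _)).directed_le
  rw [Vlt, iSup_subtype', Submodule.mem_iSup_of_directed _ hdir]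
  simp

theorem T_smul_mem_Vlt {V : ℝ → Submodule ℂ NN} {A : Finset ℝ}
    (hV : IsVLattice (zmul NN) V A) (k : ℤ) {β : ℝ} {x : NN} (hx : x ∈ Vlt V β) :
    (T k : L) • x ∈ Vlt V (β + k) := by
  rw [mem_Vlt_iff hV.mono] at hx ⊢
  obtain ⟨γ, hγ, hx⟩ := hx
  exact ⟨γ + k, by gcongr, T_smul_mem_of_isVLattice hV k hx⟩

theorem Vlt_mono (V : ℝ → Submodule ℂ N) : Monotone (Vlt V) := fun _ _ h =>
  biSup_mono fun _ hγ => lt_of_lt_of_le hγ h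

theorem T_smul_mem_of_isFreeLattice {M : Submodule ℂ NN} {r : ℕ}
    (hM : IsFreeLattice (zmul NN) M r) (n : ℕ) {x : NN} (hx : x ∈ M) :
    (T (n : ℤ) : L) • x ∈ M := by
  induction n with
  | zero => simpa using hx
  | succ n ih =>
    rw [Nat.cast_succ, add_comm, ← T_smul_T_smul]
    exact hM.1 _ ih

theorem exists_T_smul_mem {M : Submodule ℂ NN} {r : ℕ} (hM : IsFreeLattice (zmul NN) M r)
    (x : NN) : ∃ n : ℕ, (T (n : ℤ) : L) • x ∈ M := by
  obtain ⟨b, -, hb, hbM⟩ := hM.2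
  have hx : x ∈ Submodule.span ℂ (Set.range fun p : Fin r × ℤ => (zmul NN ^ p.2) (b p.1)) :=
    hb ▸ Submodule.mem_top
  have key : ∀ {m n : ℕ} {y : NN}, m ≤ n → (T (m : ℤ) : L) • y ∈ M → (T (n : ℤ) : L) • y ∈ M := by
    intro m n y hmn hy
    obtain ⟨d, rfl⟩ := Nat.exists_eq_add_of_le hmn
    rw [Nat.cast_add, add_comm, ← T_smul_T_smul]
    exact T_smul_mem_of_isFreeLattice hM d hy
  induction hx using Submodule.span_induction with
  | mem x hx =>
    obtain ⟨p, rfl⟩ := hx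
    refine ⟨p.2.natAbs, ?_⟩
    rw [← hbM]
    refine Submodule.subset_span ⟨(p.1, (p.2.natAbs + p.2).toNat), ?_⟩
    simp only [zmul_zpow_apply, T_smul_T_smul]
    rw [Int.toNat_of_nonneg (by omega)]
  | zero => exact ⟨0, by simp⟩
  | add x y _ _ hx hy =>
    obtain ⟨m, hm⟩ := hx
    obtain ⟨n, hn⟩ := hy
    refine ⟨max m n, ?_⟩
    rw [smul_add]
    exact M.add_mem (key (le_max_left _ _) hm) (key (le_max_right _ _) hn)
  | smul c x _ hx =>
    obtain ⟨n, hn⟩ := hx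
    exact ⟨n, by rw [smul_comm]; exact M.smul_mem c hn⟩

theorem finite_of_isFreeLattice {M : Submodule ℂ NN} {r : ℕ}
    (hM : IsFreeLattice (zmul NN) M r) : Module.Finite L NN := by
  obtain ⟨b, -, hb, -⟩ := hM.2
  refine ⟨Submodule.fg_def.mpr ⟨Set.range b, Set.finite_range b, ?_⟩⟩
  rw [eq_top_iff]
  intro x _
  have hx : x ∈ Submodule.span ℂ (Set.range fun p : Fin r × ℤ => (zmul NN ^ p.2) (b p.1)) :=
    hb ▸ Submodule.mem_top
  refine (Submodule.span_le (p := (Submodule.span L (Set.range b)).restrictScalars ℂ)).mpr ?_ hx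
  rintro _ ⟨p, rfl⟩
  simp only [zmul_zpow_apply]
  exact (Submodule.span L (Set.range b)).smul_mem _
    (Submodule.subset_span (Set.mem_range_self p.1))

theorem eq_zero_of_T_smul_eq_zero {P : Type*} [AddCommGroup P] [Module L P] (k : ℤ) {x : P}
    (h : (T k : L) • x = 0) : x = 0 := by
  simpa [T_smul_T_smul] using congrArg ((T (-k) : L) • ·) h

theorem eq_zero_of_sum_T_smul_eq_zero {M E : Submodule ℂ NN}
    (hE : IsInternalDirectSum (fun j : ℕ => E.map ((zmul NN ^ (j : ℤ)).toLinearMap)) M)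
    (S : Finset ℤ) (g : ℤ → NN) (hg : ∀ k ∈ S, g k ∈ E)
    (h : ∑ k ∈ S, (T k : L) • g k = 0) : ∀ k ∈ S, g k = 0 := by
  obtain ⟨n, hn⟩ : ∃ n : ℕ, ∀ k ∈ S, 0 ≤ n + k := by
    refine ⟨∑ k ∈ S, k.natAbs, fun k hk => ?_⟩
    have := Finset.single_le_sum (f := Int.natAbs) (fun _ _ => Nat.zero_le _) hk
    omega
  have hind : iSupIndep (fun j : ℕ => E.map ((zmul NN ^ (j : ℤ)).toLinearMap)) :=
    fun i => disjoint_iff.mpr (hE.2 i)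
  have hinj : Function.Injective (fun k : S => (n + (k : ℤ)).toNat) := by
    intro a b hab
    have ha := hn a a.2
    have hb := hn b b.2
    simp only at hab
    apply Subtype.ext
    omega
  have hS := (iSupIndep_iff_finsetSum_eq_zero_imp_eq_zero _).mp (hind.comp hinj) Finset.univ
    (fun k : S => (T (n + (k : ℤ)) : L) • g k) (fun k _ => ?_) ?_
  · intro k hk
    exact eq_zero_of_T_smul_eq_zero _ (hS ⟨k, hk⟩ (Finset.mem_univ _))
  · refine ⟨g k, hg k k.2, ?_⟩
    simp only [LinearEquiv.coe_coe, zmul_zpow_apply, Int.toNat_of_nonneg (hn k k.2)]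
  · rw [Finset.sum_coe_sort S (fun k => (T (n + k) : L) • g k)]
    simp_rw [← T_smul_T_smul, ← Finset.smul_sum, h, smul_zero]

theorem exists_basis_of_trivializing {M E : Submodule ℂ NN} {r : ℕ}
    (hM : IsFreeLattice (zmul NN) M r)
    (hE : IsInternalDirectSum (fun j : ℕ => E.map ((zmul NN ^ (j : ℤ)).toLinearMap)) M) :
    ∃ (n : ℕ) (b : Module.Basis (Fin n) L NN), Submodule.span ℂ (Set.range b) = E := by
  classical
  let e := Module.Basis.ofVectorSpace ℂ E
  have hspan : Submodule.span ℂ (Set.range fun i => (e i : NN)) = E := by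
    have := congrArg (Submodule.map E.subtype) e.span_eq
    rwa [Submodule.map_span, ← Set.range_comp, Submodule.map_top, Submodule.range_subtype] at this
  have hli : LinearIndependent L (fun i => (e i : NN)) := by
    rw [linearIndependent_iff']
    intro s f hf i hi
    set S : Finset ℤ := s.biUnion fun i => (f i).coeff.support
    have hsum : ∑ k ∈ S, (T k : L) • (∑ i ∈ s, (f i).coeff k • (e i : NN)) = 0 := by
      rw [← hf]
      simp_rw [Finset.smul_sum]
      rw [Finset.sum_comm]
      refine Finset.sum_congr rfl fun i hi => ?_
      conv_rhs => rw [eq_sum_coeff_smul_T (f i)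
        (Finset.subset_biUnion_of_mem (fun i => (f i).coeff.support) hi), Finset.sum_smul]
      exact Finset.sum_congr rfl fun k _ => by rw [smul_assoc, smul_comm]
    have h0 := eq_zero_of_sum_T_smul_eq_zero hE S _
      (fun k _ => E.sum_mem fun i _ => E.smul_mem _ (e i).2) hsum
    have hC : LinearIndependent ℂ (fun i => (e i : NN)) :=
      e.linearIndependent.map' E.subtype E.ker_subtype
    rw [linearIndependent_iff'] at hC
    apply LaurentPolynomial.ext
    intro k
    by_cases hk : k ∈ S
    · exact hC s _ (h0 k hk) i hi
    · by_contra hne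
      exact hk (Finset.mem_biUnion.mpr ⟨i, hi, Finsupp.mem_support_iff.mpr hne⟩)
  have hEtop : ∀ x ∈ E, x ∈ Submodule.span L (Set.range fun i => (e i : NN)) := fun x hx =>
    Submodule.span_le_restrictScalars ℂ L _ (hspan.symm ▸ hx)
  have htop : ⊤ ≤ Submodule.span L (Set.range fun i => (e i : NN)) := by
    intro x _
    obtain ⟨n, hn⟩ := exists_T_smul_mem hM x
    have hx : (T (n : ℤ) : L) • x ∈ Submodule.span L (Set.range fun i => (e i : NN)) := by
      rw [← hE.1] at hn
      refine (iSup_le ?_ : _ ≤ (Submodule.span L _).restrictScalars ℂ) hn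
      rintro j _ ⟨y, hy, rfl⟩
      simp only [LinearEquiv.coe_coe, zmul_zpow_apply]
      exact Submodule.smul_mem _ _ (hEtop y hy)
    have := Submodule.smul_mem _ (T (-(n : ℤ)) : L) hx
    rwa [T_smul_T_smul, neg_add_cancel, T_zero, one_smul] at this
  let b := Module.Basis.mk hli htop
  have := finite_of_isFreeLattice hM
  have := Module.Finite.finite_basis b
  obtain ⟨n, ⟨σ⟩⟩ := Finite.exists_equiv_fin (Module.Basis.ofVectorSpaceIndex ℂ E)
  refine ⟨n, b.reindex σ, ?_⟩
  rw [Module.Basis.range_reindex, Module.Basis.coe_mk, hspan]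

theorem Vlt_le_of_forall_T_smul_mem {M E : Submodule ℂ NN} {r : ℕ} {V : ℝ → Submodule ℂ NN}
    {A : Finset ℝ} (hM : IsFreeLattice (zmul NN) M r) (hV : IsVLattice (zmul NN) V A)
    (hE : IsVAdapted (zmul NN) V M E) {γ : ℝ} {P : Submodule ℂ NN}
    (hP : ∀ k : ℤ, ∀ e ∈ Vlt V (γ - k) ⊓ E, (T k : L) • e ∈ P) : Vlt V γ ≤ P := by
  intro x hx
  obtain ⟨γ', hγ', hx⟩ := (mem_Vlt_iff hV.mono).mp hx
  obtain ⟨n, hn⟩ := exists_T_smul_mem hM x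
  have hxn : (T (n : ℤ) : L) • x ∈ V (γ' + (n : ℤ)) ⊓ M :=
    ⟨T_smul_mem_of_isVLattice hV n hx, hn⟩
  rw [← (hE.2.2 _).1] at hxn
  have hle : (⨆ j : ℕ, (V (γ' + (n : ℤ) - j) ⊓ E).map ((zmul NN ^ (j : ℤ)).toLinearMap)) ≤
      P.comap ((zmul NN ^ (-(n : ℤ))).toLinearMap) := by
    refine iSup_le ?_
    rintro j _ ⟨y, hy, rfl⟩
    simp only [Submodule.mem_comap, LinearEquiv.coe_coe, zmul_zpow_apply, T_smul_T_smul]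
    refine hP _ y ⟨(mem_Vlt_iff hV.mono).mpr ⟨_, ?_, hy.1⟩, hy.2⟩
    push_cast
    linarith
  have := hle hxn
  simpa only [Submodule.mem_comap, LinearEquiv.coe_coe, zmul_zpow_apply, T_smul_T_smul,
    neg_add_cancel, T_zero, one_smul] using this

/-- The component of degree `k` of a functional on a free `ℂ[z,z⁻¹]`-module with respect to
a basis: its value on each basis vector is the `k`-th coefficient of the original value. -/
def component {n : ℕ} (b : Module.Basis (Fin n) L NN) (k : ℤ) :
    (NN →ₗ[L] L) →ₗ[ℂ] (NN →ₗ[L] L) where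
  toFun φ := b.constr ℂ fun i => algebraMap ℂ L ((φ (b i)).coeff k)
  map_add' φ ψ := b.ext fun i => by
    simp
  map_smul' c φ := b.ext fun i => by
    rw [LinearMap.smul_apply, b.constr_basis, RingHom.id_apply, LinearMap.smul_apply,
      b.constr_basis, AddMonoidAlgebra.coeff_smul_apply, smul_eq_mul, map_mul, Algebra.smul_def]

theorem component_basis {P : Type*} [AddCommGroup P] [Module L P] {n : ℕ}
    (b : Module.Basis (Fin n) L P) (k : ℤ) (φ : P →ₗ[L] L) (i : Fin n) :
    component b k φ (b i) = algebraMap ℂ L ((φ (b i)).coeff k) :=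
  b.constr_basis ℂ _ i

set_option linter.unusedSectionVars false

section Component

variable {n : ℕ} (b : Module.Basis (Fin n) L NN) {E : Submodule ℂ NN}

theorem component_apply (hb : Submodule.span ℂ (Set.range b) = E) (k : ℤ) (φ : NN →ₗ[L] L)
    {e : NN} (he : e ∈ E) : component b k φ e = algebraMap ℂ L ((φ e).coeff k) := by
  rw [← hb] at he
  induction he using Submodule.span_induction with
  | mem x hx => obtain ⟨i, rfl⟩ := hx; exact component_basis b k φ i
  | zero => simp
  | add x y _ _ hx hy => simp [hx, hy]
  | smul c x _ hx =>
    rw [LinearMap.map_smul_of_tower, LinearMap.map_smul_of_tower, hx,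
      AddMonoidAlgebra.coeff_smul_apply, smul_eq_mul, map_mul, Algebra.smul_def]

theorem component_mem_dualE (hb : Submodule.span ℂ (Set.range b) = E) (k : ℤ)
    (φ : NN →ₗ[L] L) : component b k φ ∈ dualE E :=
  fun _ he => ⟨_, component_apply b hb k φ he⟩

theorem component_lT (hb : Submodule.span ℂ (Set.range b) = E) (j k : ℤ) {φ : NN →ₗ[L] L}
    (hφ : φ ∈ dualE E) : component b k (lT j φ) = if j = k then φ else 0 := by
  refine b.ext fun i => ?_
  obtain ⟨c, hc⟩ := hφ (b i) (hb ▸ Submodule.subset_span (Set.mem_range_self i))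
  rw [component_basis]
  change algebraMap ℂ L ((T j * φ (b i) : L).coeff k) = _
  rw [coeff_T_mul, hc]
  split_ifs with h
  · rw [h, sub_self, coeff_algebraMap_zero, hc]
  · rw [coeff_algebraMap_of_ne (by omega), map_zero, LinearMap.zero_apply]

theorem eq_sum_lT_component (φ : NN →ₗ[L] L) :
    ∃ S : Finset ℤ, φ = ∑ k ∈ S, lT k (component b k φ) := by
  refine ⟨Finset.univ.biUnion fun i => (φ (b i)).coeff.support, b.ext fun i => ?_⟩
  rw [LinearMap.sum_apply]
  conv_lhs => rw [eq_sum_coeff_smul_T (φ (b i)) (Finset.subset_biUnion_of_mem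
    (fun i => (φ (b i)).coeff.support) (Finset.mem_univ i))]
  refine Finset.sum_congr rfl fun k _ => ?_
  change _ = T k * component b k φ (b i)
  rw [component_basis, Algebra.smul_def, mul_comm]

theorem isInternalDirectSum_map_lT (hb : Submodule.span ℂ (Set.range b) = E) {ι : Type*}
    {d : ι → ℤ} (hd : Function.Injective d) {D : ι → Submodule ℂ (NN →ₗ[L] L)}
    {W : Submodule ℂ (NN →ₗ[L] L)} (hD : ∀ i, D i ≤ dualE E)
    (hDW : ∀ i, ∀ φ ∈ D i, lT (d i) φ ∈ W)
    (hWD : ∀ i, ∀ φ ∈ W, component b (d i) φ ∈ D i)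
    (hW : ∀ k ∉ Set.range d, ∀ φ ∈ W, component b k φ = 0) :
    IsInternalDirectSum (fun i => (D i).map (lT (d i))) W := by
  refine ⟨le_antisymm (iSup_le ?_) ?_, fun i => ?_⟩
  · rintro i _ ⟨φ, hφ, rfl⟩
    exact hDW i φ hφ
  · intro φ hφ
    obtain ⟨S, hS⟩ := eq_sum_lT_component b φ
    rw [hS]
    refine Submodule.sum_mem _ fun k _ => ?_
    by_cases hk : k ∈ Set.range d
    · obtain ⟨i, rfl⟩ := hk
      exact Submodule.mem_iSup_of_mem i (Submodule.mem_map_of_mem (hWD i φ hφ))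
    · rw [hW k hk φ hφ, map_zero]
      exact zero_mem _
  · rw [eq_bot_iff]
    rintro x ⟨⟨φ, hφ, rfl⟩, hx⟩
    have hle : (⨆ (j : ι) (_ : j ≠ i), (D j).map (lT (d j))) ≤
        LinearMap.ker (component b (d i)) := by
      refine iSup₂_le ?_
      rintro j hj _ ⟨ψ, hψ, rfl⟩
      rw [LinearMap.mem_ker, component_lT b hb _ _ (hD j hψ), if_neg fun h => hj (hd h)]
    have h0 := hle hx
    rw [LinearMap.mem_ker, component_lT b hb _ _ (hD i hφ), if_pos rfl] at h0
    rw [h0, map_zero]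
    exact zero_mem _

theorem component_eq_zero_of_mem_dualM (hb : Submodule.span ℂ (Set.range b) = E)
    {M : Submodule ℂ NN} (hEM : E ≤ M) {φ : NN →ₗ[L] L} (hφ : φ ∈ dualM M) {k : ℤ}
    (hk : k < 0) : component b k φ = 0 := by
  refine b.ext fun i => ?_
  have hi : b i ∈ E := hb ▸ Submodule.subset_span (Set.mem_range_self i)
  rw [component_basis, coeff_eq_zero_of_mem_polyZ (hφ _ (hEM hi)) hk, map_zero,
    LinearMap.zero_apply]

theorem component_mem_annih (hb : Submodule.span ℂ (Set.range b) = E)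
    {V : ℝ → Submodule ℂ NN} {A : Finset ℝ} (hV : IsVLattice (zmul NN) V A) {γ : ℝ}
    {φ : NN →ₗ[L] L} (hφ : φ ∈ dualV V γ) (k : ℤ) :
    component b k φ ∈ annih (Vlt V ((k : ℝ) - γ) ⊓ E) := by
  rintro e ⟨heV, heE⟩
  have h : (T (1 - k) : L) • e ∈ Vlt V (1 - γ) := by
    convert T_smul_mem_Vlt hV (1 - k) heV using 2
    push_cast
    ring
  have hc := coeff_eq_zero_of_mem_polyZinv (hφ _ h) one_pos
  rw [map_smul, smul_eq_mul, coeff_T_mul, sub_sub_cancel] at hc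
  rw [component_apply b hb k φ heE, hc, map_zero]

end Component

theorem lT_mem_dualM {M E : Submodule ℂ NN}
    (hE : IsInternalDirectSum (fun j : ℕ => E.map ((zmul NN ^ (j : ℤ)).toLinearMap)) M)
    (j : ℕ) {φ : NN →ₗ[L] L} (hφ : φ ∈ dualE E) : lT (j : ℤ) φ ∈ dualM M := by
  intro m hm
  rw [← hE.1] at hm
  refine (iSup_le ?_ : _ ≤ polyZ.comap ((lT (j : ℤ) φ).restrictScalars ℂ)) hm
  rintro i _ ⟨e, he, rfl⟩
  obtain ⟨c, hc⟩ := hφ e he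
  simp only [Submodule.mem_comap, LinearEquiv.coe_coe, zmul_zpow_apply]
  change (T (j : ℤ) * φ ((T (i : ℤ) : L) • e) : L) ∈ polyZ
  rw [map_smul, smul_eq_mul, ← mul_assoc, ← T_add, hc]
  exact T_mul_algebraMap_mem_polyZ (by positivity) c

theorem lT_mem_dualV {M E : Submodule ℂ NN} {r : ℕ} {V : ℝ → Submodule ℂ NN}
    {A : Finset ℝ} (hM : IsFreeLattice (zmul NN) M r) (hV : IsVLattice (zmul NN) V A)
    (hE : IsVAdapted (zmul NN) V M E) {γ : ℝ} (k : ℤ) {φ : NN →ₗ[L] L}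
    (hφ : φ ∈ dualE E ⊓ annih (Vlt V ((k : ℝ) - γ) ⊓ E)) : lT k φ ∈ dualV V γ := by
  intro x hx
  refine (Vlt_le_of_forall_T_smul_mem hM hV hE ?_ :
    _ ≤ polyZinv.comap ((lT k φ).restrictScalars ℂ)) hx
  rintro j e ⟨heV, heE⟩
  change (T k * φ ((T j : L) • e) : L) ∈ polyZinv
  rw [map_smul, smul_eq_mul, ← mul_assoc, ← T_add]
  rcases le_or_gt (k + j) 0 with hkj | hkj
  · obtain ⟨c, hc⟩ := hφ.1 e heE
    rw [hc]
    exact T_mul_algebraMap_mem_polyZinv hkj c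
  · have hkj' : (1 : ℝ) ≤ k + j := by exact_mod_cast hkj
    rw [hφ.2 e ⟨Vlt_mono V (by linarith) heV, heE⟩, mul_zero]
    exact zero_mem _

/-- Intermediate decomposition in the proof of Proposition 3.2.15.  Let `E` be a
V-adapted trivializing subspace of `M` and `Ě := {φ ∈ N^∨ : φ(E) ⊆ ℂ·1}`.  Then:
(i) `Ě ⊆ M^∨` and `M^∨ = ⊕_{j≥0} z^j·Ě`;
(ii) for every `γ`, `V^∨_γ = ⊕_{k∈ℤ} z^k·{φ ∈ Ě : φ(V_{<k−γ} ∩ E) = 0}`;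
(iii) consequently `Ě` is a V-adapted trivializing subspace for `(M^∨, V^∨)` and
`V^∨_γ ∩ Ě = {φ ∈ Ě : φ(V_{<−γ} ∩ E) = 0}`. -/
theorem statement13
    (M : Submodule ℂ NN) (r : ℕ) (V : ℝ → Submodule ℂ NN) (A : Finset ℝ)
    (E : Submodule ℂ NN)
    (hM : IsFreeLattice (zmul NN) M r) (hV : IsVLattice (zmul NN) V A)
    (hE : IsVAdapted (zmul NN) V M E) :
    -- (i)
    (dualE E ≤ dualM M ∧
      IsInternalDirectSum (fun j : ℕ => (dualE E).map (lT (j : ℤ))) (dualM M)) ∧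
    -- (ii)
    (∀ γ : ℝ, IsInternalDirectSum
      (fun k : ℤ => ((dualE E ⊓ annih (Vlt V ((k : ℝ) - γ) ⊓ E)).map (lT k)))
      (dualV V γ)) ∧
    -- (iii)
    ((∀ γ : ℝ, IsInternalDirectSum
        (fun j : ℕ => ((dualV V (γ - j) ⊓ dualE E).map (lT (j : ℤ))))
        (dualV V γ ⊓ dualM M)) ∧
      ∀ γ : ℝ, dualV V γ ⊓ dualE E = dualE E ⊓ annih (Vlt V (-γ) ⊓ E)) := by
  obtain ⟨n, b, hb⟩ := exists_basis_of_trivializing hM hE.2.1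
  have hneg : ∀ k ∉ Set.range (Nat.cast : ℕ → ℤ), k < 0 := fun k hk =>
    not_le.mp fun h => hk ⟨k.toNat, Int.toNat_of_nonneg h⟩
  have lT_zero : ∀ φ : NN →ₗ[L] L, lT 0 φ = φ := fun φ => by
    change (T 0 : L) • φ = φ
    rw [T_zero, one_smul]
  have hdual : ∀ γ : ℝ, dualV V γ ⊓ dualE E = dualE E ⊓ annih (Vlt V (-γ) ⊓ E) := by
    intro γ
    ext φ
    constructor
    · rintro ⟨hφV, hφE⟩
      have h := component_mem_annih b hb hV hφV 0
      rw [← lT_zero φ, component_lT b hb 0 0 hφE, if_pos rfl, Int.cast_zero, zero_sub] at h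
      exact ⟨hφE, h⟩
    · intro hφ
      refine ⟨?_, hφ.1⟩
      rw [← lT_zero φ]
      refine lT_mem_dualV hM hV hE 0 ?_
      rwa [Int.cast_zero, zero_sub]
  refine ⟨⟨fun φ hφ => ?_, ?_⟩, fun γ => ?_, fun γ => ?_, hdual⟩
  · rw [← lT_zero φ]
    exact lT_mem_dualM hE.2.1 0 hφ
  · exact isInternalDirectSum_map_lT b hb Nat.cast_injective (fun _ => le_rfl)
      (fun j φ hφ => lT_mem_dualM hE.2.1 j hφ) (fun j φ _ => component_mem_dualE b hb j φ)
      (fun k hk φ hφ => component_eq_zero_of_mem_dualM b hb hE.1 hφ (hneg k hk))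
  · exact isInternalDirectSum_map_lT b hb Function.injective_id (fun _ => inf_le_left)
      (fun k φ hφ => lT_mem_dualV hM hV hE k hφ)
      (fun k φ hφ => ⟨component_mem_dualE b hb k φ, component_mem_annih b hb hV hφ k⟩)
      (fun k hk => absurd ⟨k, rfl⟩ hk)
  · have hdual' : ∀ j : ℕ, dualV V (γ - j) ⊓ dualE E =
        dualE E ⊓ annih (Vlt V (((j : ℤ) : ℝ) - γ) ⊓ E) := fun j => by
      rw [hdual, neg_sub, Int.cast_natCast]
    simp_rw [hdual']
    exact isInternalDirectSum_map_lT b hb Nat.cast_injective (fun _ => inf_le_left)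
      (fun j φ hφ => ⟨lT_mem_dualV hM hV hE j hφ, lT_mem_dualM hE.2.1 j hφ.1⟩)
      (fun j φ hφ => ⟨component_mem_dualE b hb j φ, component_mem_annih b hb hV hφ.1 j⟩)
      (fun k hk φ hφ => component_eq_zero_of_mem_dualM b hb hE.1 hφ.2 (hneg k hk))
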